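/- Let k ≥ 1 be an integer. Every C_{≤2k+1}-free simple graph G on n vertices with minimum degree δ(G) > (2/(2k+3))·n is bipartite. -/

import Mathlib

namespace SimpleGraph.Walk

variable {V : Type*} {G : SimpleGraph V}

/-- Two positions on a closed walk are joined by its two complementary arcs. -/
lemma exists_arcs {u : V} (p : G.Walk u u) {i j : ℕ} (hij : i ≤ j) (hj : j ≤ p.length) :
    (∃ q : G.Walk (p.getVert i) (p.getVert j), q.length = j - i) ∧
      ∃ q : G.Walk (p.getVert j) (p.getVert i), q.length = p.length - (j - i) := by
  refine ⟨⟨((p.drop i).take (j - i)).copy rfl ?_, ?_⟩, (p.drop j).append (p.take i), ?_⟩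
  · rw [drop_getVert, Nat.add_sub_cancel' hij]
  · simp only [length_copy, take_length, drop_length]
    omega
  · simp only [length_append, take_length, drop_length]
    omega

/-- A shortest odd closed walk is a cycle. -/
lemma isCycle_of_odd_of_forall_length_le {u : V} {p : G.Walk u u} (hodd : Odd p.length)
    (hmin : ∀ (x : V) (c : G.Walk x x), Odd c.length → p.length ≤ c.length) : p.IsCycle := by
  have hne : p.length ≠ 1 := fun h ↦ G.irrefl (adj_of_length_eq_one h)
  have hnil : ¬ p.Nil := fun h ↦ by
    rw [length_eq_zero_iff.mpr h] at hodd
    simp at hodd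
  have hinj : ∀ i j, i < j → j < p.length → p.getVert (i + 1) ≠ p.getVert (j + 1) := by
    intro i j hij hj heq
    obtain ⟨⟨q, hq⟩, r, hr⟩ := p.exists_arcs (i := i + 1) (j := j + 1) (by omega) (by omega)
    have hq' := hmin _ (q.copy heq rfl)
    have hr' := hmin _ (r.copy rfl heq)
    rw [length_copy, hq, Nat.odd_iff] at hq'
    rw [length_copy, hr, Nat.odd_iff] at hr'
    rw [Nat.odd_iff] at hodd
    omega
  have hlen := length_tail_add_one hnil
  rw [isCycle_iff_isPath_tail_and_le_length, ← IsPath.getVert_injOn_iff]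
  refine ⟨fun i hi j hj heq ↦ ?_, ?_⟩
  · simp only [Set.mem_ofPred_eq] at hi hj
    simp only [getVert_tail] at heq
    rcases lt_trichotomy i j with h | h | h
    · exact absurd heq (hinj i j h (by omega))
    · exact h
    · exact absurd heq.symm (hinj j i h (by omega))
  · rw [Nat.odd_iff] at hodd
    omega

/-- Two neighbors of a common vertex on a shortest odd closed walk are at distance two along it. -/
lemma sub_eq_two_or_of_adj_of_adj {u v : V} {p : G.Walk u u} (hodd : Odd p.length)
    (hmin : ∀ (x : V) (c : G.Walk x x), Odd c.length → p.length ≤ c.length) {i j : ℕ}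
    (hij : i < j) (hj : j < p.length) (hvi : G.Adj (p.getVert i) v)
    (hvj : G.Adj (p.getVert j) v) : j - i = 2 ∨ j - i = p.length - 2 := by
  obtain ⟨⟨q, hq⟩, r, hr⟩ := p.exists_arcs hij.le hj.le
  have hq' := hmin _ (cons hvi.symm (q.concat hvj))
  have hr' := hmin _ (cons hvj.symm (r.concat hvi))
  rw [length_cons, length_concat, hq, Nat.odd_iff] at hq'
  rw [length_cons, length_concat, hr, Nat.odd_iff] at hr'
  rw [Nat.odd_iff] at hodd
  omega

/-- Every vertex has at most two neighbors on a shortest odd closed walk of length at least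
five. -/
lemma card_adj_getVert_le_two [DecidableRel G.Adj] {u : V} {p : G.Walk u u}
    (hodd : Odd p.length)
    (hmin : ∀ (x : V) (c : G.Walk x x), Odd c.length → p.length ≤ c.length)
    (hlen : 5 ≤ p.length) (v : V) :
    ((Finset.range p.length).filter fun i ↦ G.Adj (p.getVert i) v).card ≤ 2 := by
  have key : ∀ i j l, i < j → j < l → l < p.length → G.Adj (p.getVert i) v →
      G.Adj (p.getVert j) v → ¬ G.Adj (p.getVert l) v := by
    intro i j l hij hjl hl hi hj hl'
    have h₁ := sub_eq_two_or_of_adj_of_adj hodd hmin hij (by omega) hi hj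
    have h₂ := sub_eq_two_or_of_adj_of_adj hodd hmin hjl hl hj hl'
    have h₃ := sub_eq_two_or_of_adj_of_adj hodd hmin (hij.trans hjl) hl hi hl'
    rw [Nat.odd_iff] at hodd
    omega
  by_contra! h
  obtain ⟨a, b, c, ha, hb, hc, hab, hac, hbc⟩ := Finset.two_lt_card_iff.mp h
  simp only [Finset.mem_filter, Finset.mem_range] at ha hb hc
  grind

/-- Double counting the edges leaving a shortest odd closed walk of length at least five. -/
lemma length_mul_minDegree_le [Fintype V] [DecidableRel G.Adj] {u : V} {p : G.Walk u u}
    (hodd : Odd p.length)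
    (hmin : ∀ (x : V) (c : G.Walk x x), Odd c.length → p.length ≤ c.length)
    (hlen : 5 ≤ p.length) : p.length * G.minDegree ≤ Fintype.card V * 2 := by
  have h := Finset.card_mul_le_card_mul (s := Finset.range p.length) (t := Finset.univ)
    (fun i v ↦ G.Adj (p.getVert i) v) (m := G.minDegree) (n := 2)
    (fun i _ ↦ ?_) (fun v _ ↦ card_adj_getVert_le_two hodd hmin hlen v)
  · simpa using h
  · rw [Finset.bipartiteAbove, ← neighborFinset_eq_filter, card_neighborFinset_eq_degree]
    exact G.minDegree_le_degree _

end SimpleGraph.Walk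

/-- **Andrásfai–Erdős–Sós theorem for odd cycles.** Let `k ≥ 1`. Every simple graph on `n`
vertices containing no odd cycle of length at most `2k+1`, with minimum degree greater
than `(2/(2k+3)) * n`, is bipartite. -/
theorem stmt_1 {V : Type*} [Fintype V] (k : ℕ) (hk : 1 ≤ k)
    (G : SimpleGraph V) [DecidableRel G.Adj]
    (hfree : ∀ (x : V) (c : G.Walk x x), c.IsCycle → Odd c.length → 2 * k + 1 < c.length)
    (hdeg : (G.minDegree : ℝ) > 2 / (2 * (k : ℝ) + 3) * (Fintype.card V : ℝ)) :
    G.Colorable 2 := by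
  classical
  rw [SimpleGraph.two_colorable_iff_forall_loop_even]
  by_contra! hcon
  obtain ⟨x, c, hc⟩ := hcon
  have hex : ∃ n, ∃ (u : V) (p : G.Walk u u), Odd p.length ∧ p.length = n :=
    ⟨_, x, c, Nat.not_even_iff_odd.mp hc, rfl⟩
  obtain ⟨u, p, hodd, hp⟩ := Nat.find_spec hex
  have hmin (y : V) (d : G.Walk y y) (hd : Odd d.length) : p.length ≤ d.length :=
    hp.trans_le (Nat.find_min' hex ⟨y, d, hd, rfl⟩)
  have hlt := hfree u p (SimpleGraph.Walk.isCycle_of_odd_of_forall_length_le hodd hmin) hodd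
  have hlen : 2 * k + 3 ≤ p.length := by
    rw [Nat.odd_iff] at hodd
    omega
  have hcount : (2 * k + 3) * G.minDegree ≤ Fintype.card V * 2 :=
    (Nat.mul_le_mul_right _ hlen).trans
      (SimpleGraph.Walk.length_mul_minDegree_le hodd hmin (by omega))
  have hcount' : (2 * (k : ℝ) + 3) * G.minDegree ≤ Fintype.card V * 2 := by exact_mod_cast hcount
  rw [gt_iff_lt, div_mul_eq_mul_div, div_lt_iff₀ (by positivity)] at hdeg
  linarith
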